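/- Let X be a metrizable space in which every point has a separable neighborhood, and let C_S(X) = {f ∈ C_B(X) : supp(f) is separable} and Y = ⋃{ cl_{βX}S : S ⊆ X is separable } ⊆ βX. Then: (a) C_S(X) is a closed ideal of C_B(X); (b) Y is an open subspace of βX (hence locally compact Hausdorff) containing X as a dense subspace, and C_S(X) is isometrically isomorphic to C_0(Y); (c) Y is countably compact and C_0(Y) = C_00(Y); (d) the following are equivalent: Y is normal; Y is compact; X is separable; C_S(X) has a multiplicative unit; (e) if X is not separable, then the dimension of C_S(X) as a complex vector space equals d(X)^{ℵ₀}, where d(X) is the least cardinality of a dense subset of X. -/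

import Mathlib

open Set Filter Topology BoundedContinuousFunction TopologicalSpace

noncomputable section

/-- `C_S(X)`: bounded continuous functions with separable support. -/
def CS (X : Type) [TopologicalSpace X] : Set (X →ᵇ ℂ) :=
  {f | IsSeparable (closure {x : X | f x ≠ 0})}

/-- `Y = ⋃ { cl_{βX} S : S ⊆ X separable }`. -/
def Yset (X : Type) [TopologicalSpace X] : Set (StoneCech X) :=
  ⋃ S ∈ {S : Set X | IsSeparable S}, closure (stoneCechUnit '' S)

/-- A set is countably compact if every countable open cover of it has a finite subcover. -/
def IsCountablyCompactSet {α : Type*} [TopologicalSpace α] (s : Set α) : Prop :=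
  ∀ U : ℕ → Set α, (∀ n, IsOpen (U n)) → s ⊆ ⋃ n, U n → ∃ t : Finset ℕ, s ⊆ ⋃ n ∈ t, U n

/-- The density `d(X)`: the least cardinality of a dense subset of `X`. -/
def densityCard (X : Type) [TopologicalSpace X] : Cardinal :=
  sInf {c : Cardinal | ∃ D : Set X, Dense D ∧ Cardinal.mk D = c}

/-- The nonuniform (countably supported) ultrafilters on `J × ℕ` do not form a normal space
when `J` is uncountable. -/
theorem not_normalSpace_countable_ultrafilters {J : Type} [Uncountable J] :
    ¬ NormalSpace {u : Ultrafilter (J × ℕ) // ∃ A ∈ u, A.Countable} := by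
  intro hN
  let E := {u : Ultrafilter (J × ℕ) // ∃ A ∈ u, A.Countable}
  let H₁ : Set E := {u | ∀ A : Set (J × ℕ), (∀ j, {n | (j, n) ∉ A}.Finite) → A ∈ u.1}
  let H₂ : Set E := {u | ∀ A : Set (J × ℕ), (∀ n, {j | (j, n) ∈ A}.Finite) → A ∉ u.1}
  have hH₁ : IsClosed H₁ := by
    have : H₁ = ⋂ (A : Set (J × ℕ)) (_ : ∀ j, {n | (j, n) ∉ A}.Finite),
        (Subtype.val ⁻¹' {u : Ultrafilter (J × ℕ) | A ∈ u} : Set E) := by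
      ext u; simp [H₁]
    rw [this]
    exact isClosed_iInter fun A => isClosed_iInter fun _ =>
      (ultrafilter_isClosed_basic A).preimage continuous_subtype_val
  have hH₂ : IsClosed H₂ := by
    have : H₂ = ⋂ (A : Set (J × ℕ)) (_ : ∀ n, {j | (j, n) ∈ A}.Finite),
        (Subtype.val ⁻¹' {u : Ultrafilter (J × ℕ) | A ∈ u}ᶜ : Set E) := by
      ext u; simp [H₂]
    rw [this]
    exact isClosed_iInter fun A => isClosed_iInter fun _ =>
      (ultrafilter_isOpen_basic A).isClosed_compl.preimage continuous_subtype_val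
  have hdisj : Disjoint H₁ H₂ := by
    rw [Set.disjoint_left]
    rintro ⟨u, A₀, hA₀, hc⟩ h1 h2
    obtain ⟨e, he⟩ := Set.countable_iff_exists_injOn.1 (hc.image Prod.fst)
    have k1 := h1 {p | p.1 ∈ Prod.fst '' A₀ → e p.1 ≤ p.2} (by
      intro j
      refine (Set.finite_lt_nat (e j)).subset ?_
      intro n hn
      simp only [mem_ofPred_eq, Classical.not_imp, not_le] at hn
      exact hn.2)
    refine h2 {p | p.1 ∈ Prod.fst '' A₀ ∧ e p.1 ≤ p.2} ?_ ?_
    · intro n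
      refine Set.Finite.of_finite_image ((Set.finite_le_nat n).subset ?_)
        (he.mono (fun j hj => hj.1))
      rintro _ ⟨j, hj, rfl⟩
      exact hj.2
    · filter_upwards [k1, hA₀] with p hp hpA
      exact ⟨⟨p, hpA, rfl⟩, hp ⟨p, hpA, rfl⟩⟩
  obtain ⟨U, V, hU, hV, hHU, hHV, hUV⟩ := normal_separation hH₁ hH₂ hdisj
  let pt : J × ℕ → E := fun p => ⟨pure p, {p}, mem_singleton p, countable_singleton p⟩
  have key : ∀ (W : Set E), IsOpen W → ∀ u ∈ W, {p | pt p ∈ W} ∈ u.1 := by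
    intro W hW u hu
    obtain ⟨O, hO, rfl⟩ := isOpen_induced_iff.1 hW
    exact u.1.tendsto_pure_self (hO.mem_nhds hu)
  have hex : ∀ {α : Type} (s : Set α), s.Infinite →
      ∃ v : Ultrafilter α, s ∈ v ∧ ∀ t : Set α, t.Finite → t ∉ v := by
    intro α s hs
    have : (cofinite ⊓ 𝓟 s).NeBot := hs.cofinite_inf_principal_neBot
    refine ⟨Ultrafilter.of (cofinite ⊓ 𝓟 s), ?_, ?_⟩
    · exact Ultrafilter.of_le _ (mem_inf_of_right (mem_principal_self s))
    · intro t ht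
      rw [← Ultrafilter.compl_mem_iff_notMem]
      exact Ultrafilter.of_le _ (mem_inf_of_left ht.compl_mem_cofinite)
  have hcol : ∀ j, ∃ n, pt (j, n) ∈ U := by
    intro j
    obtain ⟨v, -, hv⟩ := hex (univ : Set ℕ) infinite_univ
    have hu : (⟨v.map (fun n => (j, n)), range (fun n : ℕ => (j, n)),
        Filter.mem_map.2 (by simp), countable_range _⟩ : E) ∈ U := by
      apply hHU
      intro A hA
      change _ ∈ v
      have := hv _ (hA j)
      rw [← Ultrafilter.compl_mem_iff_notMem] at this
      filter_upwards [this] with n hn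
      simpa using hn
    have := key U hU _ hu
    obtain ⟨n, hn⟩ := Ultrafilter.nonempty_of_mem (f := v) this
    exact ⟨n, hn⟩
  have hrow : ∀ n, {j | pt (j, n) ∈ U}.Finite := by
    intro n
    by_contra hinf
    obtain ⟨T, hTs, hTc, hTi⟩ := Set.Infinite.exists_subset_countable_infinite hinf
    obtain ⟨v, hTv, hv⟩ := hex T hTi
    have hu : (⟨v.map (fun j => (j, n)), (fun j => (j, n)) '' T,
        Filter.mem_map.2 (mem_of_superset hTv (subset_preimage_image _ _)), hTc.image _⟩ : E)
        ∈ V := by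
      apply hHV
      intro A hA
      change _ ∉ v
      exact hv _ (hA n)
    have := key V hV _ hu
    obtain ⟨j, hj, hjT⟩ := Ultrafilter.nonempty_of_mem (f := v) (inter_mem this hTv)
    exact Set.disjoint_left.1 hUV (hTs hjT) hj
  have : (univ : Set J).Countable := by
    refine (Set.countable_iUnion fun n => (hrow n).countable).mono ?_
    intro j _
    simpa using hcol j
  exact Set.not_countable_univ this

/-- A locally separable metrizable space is a disjoint union of nonempty clopen separable
subspaces, presented as the fibers of a locally constant surjection. -/
theorem exists_isLocallyConstant_separable_fibers {X : Type} [TopologicalSpace X]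
    [MetrizableSpace X] (hloc : ∀ x : X, ∃ S ∈ nhds x, IsSeparable S) :
    ∃ (I : Type) (q : X → I), IsLocallyConstant q ∧ Function.Surjective q ∧
      ∀ i, IsSeparable (q ⁻¹' {i}) := by
  let := metrizableSpaceMetric X
  choose S hS hSs using hloc
  obtain ⟨U, hUo, hUc, hUf, hUS⟩ := precise_refinement (fun x => interior (S x))
    (fun x => isOpen_interior)
    (eq_univ_of_forall fun x => mem_iUnion.2 ⟨x, mem_interior_iff_mem_nhds.2 (hS x)⟩)
  have hUs : ∀ i, IsSeparable (U i) := fun i =>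
    (hSs i).mono ((hUS i).trans interior_subset)
  have hcov : ∀ x, ∃ i, x ∈ U i := fun x => mem_iUnion.1 (hUc ▸ mem_univ x)
  let r : X → X → Prop := fun x y => ∃ i, x ∈ U i ∧ y ∈ U i
  have hrs : ∀ {x y}, r x y → r y x := fun ⟨i, hx, hy⟩ => ⟨i, hy, hx⟩
  let s : Setoid X := ⟨Relation.ReflTransGen r,
    ⟨fun _ => Relation.ReflTransGen.refl,
      fun h => by
        induction h with
        | refl => exact Relation.ReflTransGen.refl
        | tail _ hbc ih => exact Relation.ReflTransGen.head (hrs hbc) ih,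
      fun h₁ h₂ => h₁.trans h₂⟩⟩
  refine ⟨Quotient s, Quotient.mk s, ?_, Quotient.mk_surjective, ?_⟩
  · rw [IsLocallyConstant.iff_exists_open]
    intro x
    obtain ⟨i, hi⟩ := hcov x
    exact ⟨U i, hUo i, hi, fun y hy => Quotient.sound
      (Relation.ReflTransGen.single (⟨i, hy, hi⟩ : r y x))⟩
  · intro c
    obtain ⟨x, rfl⟩ := Quotient.mk_surjective c
    have hcount : ∀ T : Set X, IsSeparable T → {i | (U i ∩ T).Nonempty}.Countable := by
      rintro T ⟨c, hc, hTc⟩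
      refine (hc.biUnion fun y _ => (hUf.point_finite y).countable).mono ?_
      rintro i ⟨y, hyU, hyT⟩
      obtain ⟨z, hzU, hzc⟩ := mem_closure_iff.1 (hTc hyT) (U i) (hUo i) hyU
      exact mem_biUnion hzc hzU
    let T : ℕ → Set X := fun n => n.rec {x} fun _ A => ⋃ i ∈ {i | (U i ∩ A).Nonempty}, U i
    have hT : ∀ n, IsSeparable (T n) := by
      intro n
      induction n with
      | zero => exact (countable_singleton x).isSeparable
      | succ n ih =>
        have := (hcount _ ih).to_subtype
        change IsSeparable (⋃ i ∈ {i | (U i ∩ T n).Nonempty}, U i)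
        rw [biUnion_eq_iUnion]
        exact IsSeparable.iUnion fun i => hUs i
    refine (IsSeparable.iUnion hT).mono ?_
    intro y hy
    have hxy : Relation.ReflTransGen r x y := Quotient.exact (mem_singleton_iff.1 hy).symm
    clear hy
    induction hxy with
    | refl => exact mem_iUnion.2 ⟨0, mem_singleton x⟩
    | tail _ hbc ih =>
      obtain ⟨n, hn⟩ := mem_iUnion.1 ih
      obtain ⟨i, hb, hc⟩ := hbc
      exact mem_iUnion.2 ⟨n + 1, mem_biUnion (show i ∈ {i | (U i ∩ T n).Nonempty} from
        ⟨_, hb, hn⟩) hc⟩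

section Decomposition

variable {X I : Type} [TopologicalSpace X] {q : X → I}

theorem IsLocallyConstant.countable_image_of_isSeparable (hq : IsLocallyConstant q) {S : Set X}
    (hS : IsSeparable S) : (q '' S).Countable := by
  obtain ⟨c, hc, hSc⟩ := hS
  refine (hc.image q).mono ?_
  rintro _ ⟨x, hx, rfl⟩
  obtain ⟨z, hz, hzc⟩ := mem_closure_iff.1 (hSc hx) (q ⁻¹' {q x}) (hq _) rfl
  exact ⟨z, hzc, hz⟩

theorem isSeparable_preimage_of_countable (hs : ∀ i, IsSeparable (q ⁻¹' {i})) {A : Set I}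
    (hA : A.Countable) : IsSeparable (q ⁻¹' A) := by
  have := hA.to_subtype
  refine (IsSeparable.iUnion fun a : A => hs a).mono ?_
  intro x hx
  exact mem_iUnion.2 ⟨⟨q x, hx⟩, rfl⟩

theorem mem_CS_iff (hq : IsLocallyConstant q) (hs : ∀ i, IsSeparable (q ⁻¹' {i}))
    {f : X →ᵇ ℂ} : f ∈ CS X ↔ ∃ A : Set I, A.Countable ∧ ∀ x, q x ∉ A → f x = 0 := by
  constructor
  · intro hf
    refine ⟨_, hq.countable_image_of_isSeparable hf, fun x hx => ?_⟩
    by_contra h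
    exact hx ⟨x, subset_closure h, rfl⟩
  · rintro ⟨A, hA, h⟩
    refine IsSeparable.closure ((isSeparable_preimage_of_countable hs hA).mono ?_)
    intro x hx
    by_contra hxA
    exact hx (h x hxA)

theorem separableSpace_iff_countable (hq : IsLocallyConstant q) (hsurj : Function.Surjective q)
    (hs : ∀ i, IsSeparable (q ⁻¹' {i})) : SeparableSpace X ↔ Countable I := by
  rw [← isSeparable_univ_iff]
  constructor
  · intro h
    have := hq.countable_image_of_isSeparable h
    rw [image_univ, hsurj.range_eq] at this
    exact countable_univ_iff.1 this
  · intro h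
    exact isSeparable_preimage_of_countable hs (A := univ) (to_countable _)

/-- The extension to `βX` of a locally constant map, valued in the ultrafilters on its target. -/
def IsLocallyConstant.ultrafilterMap (hq : IsLocallyConstant q) :
    StoneCech X → Ultrafilter I :=
  stoneCechExtend (g := fun x => (pure (q x) : Ultrafilter I)) (hq.comp _).continuous

theorem IsLocallyConstant.continuous_ultrafilterMap (hq : IsLocallyConstant q) :
    Continuous hq.ultrafilterMap :=
  continuous_stoneCechExtend _

theorem IsLocallyConstant.ultrafilterMap_unit (hq : IsLocallyConstant q) (x : X) :
    hq.ultrafilterMap (stoneCechUnit x) = pure (q x) :=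
  stoneCechExtend_stoneCechUnit _ x

theorem IsLocallyConstant.isClopen_mem_ultrafilterMap (hq : IsLocallyConstant q) (A : Set I) :
    IsClopen {y | A ∈ hq.ultrafilterMap y} :=
  ⟨(ultrafilter_isClosed_basic A).preimage hq.continuous_ultrafilterMap,
    (ultrafilter_isOpen_basic A).preimage hq.continuous_ultrafilterMap⟩

theorem mem_Yset_iff (hq : IsLocallyConstant q) (hs : ∀ i, IsSeparable (q ⁻¹' {i}))
    {y : StoneCech X} : y ∈ Yset X ↔ ∃ A : Set I, A.Countable ∧ A ∈ hq.ultrafilterMap y := by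
  simp only [Yset, mem_iUnion, exists_prop]
  constructor
  · rintro ⟨S, hS, hy⟩
    refine ⟨q '' S, hq.countable_image_of_isSeparable hS, ?_⟩
    refine closure_minimal ?_ (hq.isClopen_mem_ultrafilterMap (q '' S)).1 hy
    rintro _ ⟨x, hx, rfl⟩
    simp only [mem_ofPred_eq, hq.ultrafilterMap_unit]
    exact mem_image_of_mem q hx
  · rintro ⟨A, hA, hy⟩
    refine ⟨q ⁻¹' A, isSeparable_preimage_of_countable hs hA, ?_⟩
    have := denseRange_stoneCechUnit.open_subset_closure_inter
      (hq.isClopen_mem_ultrafilterMap A).2 hy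
    refine closure_mono ?_ this
    rintro _ ⟨hx, x, rfl⟩
    simp only [mem_ofPred_eq, hq.ultrafilterMap_unit] at hx
    exact ⟨x, hx, rfl⟩

theorem isOpen_Yset (hq : IsLocallyConstant q) (hs : ∀ i, IsSeparable (q ⁻¹' {i})) :
    IsOpen (Yset X) := by
  have : Yset X = ⋃ (A : Set I) (_ : A.Countable), {y | A ∈ hq.ultrafilterMap y} := by
    ext y; simp [mem_Yset_iff hq hs]
  rw [this]
  exact isOpen_iUnion fun A => isOpen_iUnion fun _ => (hq.isClopen_mem_ultrafilterMap A).2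

theorem range_stoneCechUnit_subset_Yset : range (stoneCechUnit : X → StoneCech X) ⊆ Yset X := by
  rintro _ ⟨x, rfl⟩
  exact mem_biUnion (show {x} ∈ {S : Set X | IsSeparable S} from
    (countable_singleton x).isSeparable) (subset_closure ⟨x, rfl, rfl⟩)

/-- A compact subset of `Y` lies over a countable set of components. -/
theorem exists_countable_of_isCompact (hq : IsLocallyConstant q)
    (hs : ∀ i, IsSeparable (q ⁻¹' {i})) {K : Set (StoneCech X)} (hK : IsCompact K)
    (hKY : K ⊆ Yset X) : ∃ A : Set I, A.Countable ∧ ∀ y ∈ K, A ∈ hq.ultrafilterMap y := by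
  refine hK.induction_on (p := fun K => ∃ A : Set I, A.Countable ∧
    ∀ y ∈ K, A ∈ hq.ultrafilterMap y) ⟨∅, countable_empty, by simp⟩ ?_ ?_ ?_
  · rintro s t hst ⟨A, hA, h⟩
    exact ⟨A, hA, fun y hy => h y (hst hy)⟩
  · rintro s t ⟨A, hA, hs⟩ ⟨B, hB, ht⟩
    refine ⟨A ∪ B, hA.union hB, ?_⟩
    rintro y (hy | hy)
    · exact mem_of_superset (hs y hy) subset_union_left
    · exact mem_of_superset (ht y hy) subset_union_right
  · intro y hy
    obtain ⟨A, hA, hyA⟩ := (mem_Yset_iff hq hs).1 (hKY hy)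
    exact ⟨_, mem_nhdsWithin_of_mem_nhds
      ((hq.isClopen_mem_ultrafilterMap A).2.mem_nhds hyA), A, hA, fun z hz => hz⟩

theorem isCountablyCompactSet_Yset (hq : IsLocallyConstant q)
    (hs : ∀ i, IsSeparable (q ⁻¹' {i})) : IsCountablyCompactSet (Yset X) := by
  intro U hU hY
  by_contra! hcon
  have : ∀ n : ℕ, ∃ y ∈ Yset X, y ∉ ⋃ k ∈ Finset.range n, U k := fun n =>
    not_subset.1 (hcon (Finset.range n))
  choose y hyY hyU using this
  have := fun n => (mem_Yset_iff hq hs).1 (hyY n)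
  choose A hA hyA using this
  have hB : (⋃ n, A n).Countable := countable_iUnion hA
  have hK := (hq.isClopen_mem_ultrafilterMap (⋃ n, A n)).1.isCompact
  obtain ⟨t, ht⟩ := hK.elim_finite_subcover U hU
    (Subset.trans (fun z hz => (mem_Yset_iff hq hs).2 ⟨_, hB, hz⟩) hY)
  obtain ⟨n, hn⟩ := t.exists_nat_subset_range
  refine hyU n (biUnion_subset_biUnion_left (fun k hk => hn hk) (ht ?_))
  exact mem_of_superset (hyA n) (subset_iUnion A n)

/-- A function on `Y` vanishing at infinity vanishes off countably many components. -/
theorem exists_countable_of_tendsto_cocompact (hq : IsLocallyConstant q)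
    (hs : ∀ i, IsSeparable (q ⁻¹' {i})) {g : Yset X → ℂ}
    (hg : Tendsto g (cocompact _) (nhds 0)) :
    ∃ A : Set I, A.Countable ∧ ∀ y : Yset X, A ∉ hq.ultrafilterMap y → g y = 0 := by
  have : ∀ n : ℕ, ∃ A : Set I, A.Countable ∧
      ∀ y : Yset X, A ∉ hq.ultrafilterMap y → ‖g y‖ < 1 / ((n : ℝ) + 1) := by
    intro n
    have h1 := hg (Metric.ball_mem_nhds 0 (Nat.one_div_pos_of_nat (n := n) (α := ℝ)))
    obtain ⟨K, hK, hKg⟩ := mem_cocompact.1 h1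
    obtain ⟨A, hA, h⟩ := exists_countable_of_isCompact hq hs
      (hK.image continuous_subtype_val) (by rintro _ ⟨y, -, rfl⟩; exact y.2)
    refine ⟨A, hA, fun y hy => ?_⟩
    have : y ∈ Kᶜ := fun hyK => hy (h y ⟨y, hyK, rfl⟩)
    simpa using hKg this
  choose A hA h using this
  refine ⟨⋃ n, A n, countable_iUnion hA, fun y hy => ?_⟩
  by_contra hne
  obtain ⟨n, hn⟩ := exists_nat_one_div_lt (norm_pos_iff.2 hne)
  exact lt_asymm hn (h n y fun hyA => hy (mem_of_superset hyA (subset_iUnion A n)))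

theorem isCompact_Yset_preimage (hq : IsLocallyConstant q)
    (hs : ∀ i, IsSeparable (q ⁻¹' {i})) {A : Set I} (hA : A.Countable) :
    IsCompact {y : Yset X | A ∈ hq.ultrafilterMap y} := by
  rw [Subtype.isCompact_iff]
  convert (hq.isClopen_mem_ultrafilterMap A).1.isCompact using 1
  ext y
  simp only [mem_image, mem_ofPred_eq, Subtype.exists, exists_and_left, exists_prop,
    exists_eq_right_right, and_iff_left_iff_imp]
  exact fun hy => (mem_Yset_iff hq hs).2 ⟨A, hA, hy⟩

theorem tendsto_cocompact_of_countable (hq : IsLocallyConstant q)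
    (hs : ∀ i, IsSeparable (q ⁻¹' {i})) {g : Yset X → ℂ} {A : Set I} (hA : A.Countable)
    (h : ∀ y : Yset X, A ∉ hq.ultrafilterMap y → g y = 0) :
    Tendsto g (cocompact _) (nhds 0) := by
  refine tendsto_const_nhds.congr' ?_
  filter_upwards [(isCompact_Yset_preimage hq hs hA).compl_mem_cocompact] with y hy
  exact (h y hy).symm

theorem hasCompactSupport_iff_tendsto (hq : IsLocallyConstant q)
    (hs : ∀ i, IsSeparable (q ⁻¹' {i})) (g : C(Yset X, ℂ)) :
    HasCompactSupport g ↔ Tendsto g (cocompact _) (nhds 0) := by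
  constructor
  · intro h
    refine tendsto_const_nhds.congr' ?_
    filter_upwards [h.isCompact.compl_mem_cocompact] with y hy
    exact (image_eq_zero_of_notMem_tsupport hy).symm
  · intro h
    obtain ⟨A, hA, h0⟩ := exists_countable_of_tendsto_cocompact hq hs h
    exact HasCompactSupport.intro (isCompact_Yset_preimage hq hs hA) h0

end Decomposition

/-- `Y` is not normal if `X` has uncountably many components. -/
theorem not_normalSpace_Yset {X I : Type} [TopologicalSpace X] [Uncountable I] {q : X → I}
    (hq : IsLocallyConstant q) (hsurj : Function.Surjective q)
    (hs : ∀ i, IsSeparable (q ⁻¹' {i})) : ¬ NormalSpace (Yset X) := by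
  intro hN
  obtain ⟨e⟩ : Nonempty (I ≃ I × ℕ) := by
    have : Infinite I := inferInstance
    rw [← Cardinal.eq]
    simp
  let q' : X → I × ℕ := e ∘ q
  have hq' : IsLocallyConstant q' := hq.comp e
  have hs' : ∀ i, IsSeparable (q' ⁻¹' {i}) := by
    intro i
    convert hs (e.symm i) using 1
    ext x
    simp [q', Equiv.eq_symm_apply]
  have hsurj' : Function.Surjective q' := e.surjective.comp hsurj
  choose s hqs using hsurj'
  let σ : Ultrafilter (I × ℕ) → StoneCech X := Ultrafilter.extend fun i => stoneCechUnit (s i)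
  have hσ : Continuous σ := continuous_ultrafilter_extend _
  have hπσ : ∀ u, hq'.ultrafilterMap (σ u) = u := by
    intro u
    refine congrFun (denseRange_pure.equalizer (hq'.continuous_ultrafilterMap.comp hσ)
      continuous_id ?_) u
    ext1 i
    simp [σ, hq'.ultrafilterMap_unit, hqs]
  let E := {u : Ultrafilter (I × ℕ) // ∃ A ∈ u, A.Countable}
  let σ' : E → Yset X := fun u => ⟨σ u.1, (mem_Yset_iff hq' hs').2 (by
    obtain ⟨A, hA, hc⟩ := u.2
    exact ⟨A, hc, by rwa [hπσ]⟩)⟩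
  let π' : Yset X → E := fun y => ⟨hq'.ultrafilterMap y, by
    obtain ⟨A, hA, hc⟩ := (mem_Yset_iff hq' hs').1 y.2
    exact ⟨A, hc, hA⟩⟩
  have hπ' : Continuous π' :=
    (hq'.continuous_ultrafilterMap.comp continuous_subtype_val).subtype_mk _
  have hσ' : Continuous σ' := (hσ.comp continuous_subtype_val).subtype_mk _
  have hleft : Function.LeftInverse π' σ' := fun u => Subtype.ext (hπσ u.1)
  exact not_normalSpace_countable_ultrafilters
    (hleft.isClosedEmbedding hπ' hσ').normalSpace

section Extension

variable {X : Type} [TopologicalSpace X]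

theorem exists_stoneCech_extension (f : X →ᵇ ℂ) :
    ∃ F : StoneCech X →ᵇ ℂ, (∀ x, F (stoneCechUnit x) = f x) ∧ ‖F‖ ≤ ‖f‖ := by
  let g : X → Metric.closedBall (0 : ℂ) ‖f‖ := fun x =>
    ⟨f x, by simpa using f.norm_coe_le_norm x⟩
  have hg : Continuous g := f.continuous.subtype_mk _
  have := isCompact_iff_compactSpace.1 (isCompact_closedBall (0 : ℂ) ‖f‖)
  refine ⟨BoundedContinuousFunction.ofNormedAddCommGroup
    (fun y => ((stoneCechExtend hg y : Metric.closedBall (0 : ℂ) ‖f‖) : ℂ))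
    (continuous_subtype_val.comp (continuous_stoneCechExtend hg)) ‖f‖
    (fun y => mem_closedBall_zero_iff.1 (stoneCechExtend hg y).2), fun x => ?_, ?_⟩
  · simp [stoneCechExtend_stoneCechUnit, g]
  · exact BoundedContinuousFunction.norm_ofNormedAddCommGroup_le _ (norm_nonneg _) _

/-- The inclusion of `X` in `Y`. -/
def unitYset (x : X) : Yset X := ⟨stoneCechUnit x, range_stoneCechUnit_subset_Yset ⟨x, rfl⟩⟩

theorem continuous_unitYset : Continuous (unitYset : X → Yset X) :=
  continuous_stoneCechUnit.subtype_mk _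

theorem denseRange_unitYset (hY : IsOpen (Yset X)) : DenseRange (unitYset : X → Yset X) := by
  have h := Dense.preimage (denseRange_stoneCechUnit (α := X)) hY.isOpenMap_subtype_val
  refine h.mono ?_
  rintro ⟨_, _⟩ ⟨x, rfl⟩
  exact ⟨x, rfl⟩

/-- The restriction to `Y` of the extension to `βX` of a bounded continuous function. -/
def extendYset (f : X →ᵇ ℂ) : Yset X →ᵇ ℂ :=
  (exists_stoneCech_extension f).choose.compContinuous ⟨Subtype.val, continuous_subtype_val⟩

theorem extendYset_unit (f : X →ᵇ ℂ) (x : X) : extendYset f (unitYset x) = f x :=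
  (exists_stoneCech_extension f).choose_spec.1 x

theorem norm_extendYset (f : X →ᵇ ℂ) : ‖extendYset f‖ = ‖f‖ := by
  refine le_antisymm ?_ ?_
  · refine (BoundedContinuousFunction.norm_compContinuous_le _ _).trans ?_
    exact (exists_stoneCech_extension f).choose_spec.2
  · refine (BoundedContinuousFunction.norm_le (norm_nonneg _)).2 fun x => ?_
    rw [← extendYset_unit]
    exact (extendYset f).norm_coe_le_norm _

theorem eq_of_comp_unitYset_eq (hY : IsOpen (Yset X)) {g h : Yset X →ᵇ ℂ}
    (hgh : ∀ x, g (unitYset x) = h (unitYset x)) : g = h :=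
  DFunLike.coe_injective
    ((denseRange_unitYset hY).equalizer g.continuous h.continuous (funext hgh))

theorem extendYset_eq_zero {I : Type} {q : X → I} (hq : IsLocallyConstant q) {A : Set I}
    (hY : IsOpen (Yset X)) {f : X →ᵇ ℂ} (hf : ∀ x, q x ∉ A → f x = 0) (y : Yset X)
    (hy : A ∉ hq.ultrafilterMap y) : extendYset f y = 0 := by
  have hopen : IsOpen {y : Yset X | A ∉ hq.ultrafilterMap y} :=
    (hq.isClopen_mem_ultrafilterMap A).compl.2.preimage continuous_subtype_val
  have h := (denseRange_unitYset hY).open_subset_closure_inter hopen hy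
  have hcl : IsClosed {y | extendYset f y = 0} :=
    isClosed_eq (extendYset f).continuous continuous_const
  refine closure_minimal ?_ hcl h
  rintro _ ⟨hx, x, rfl⟩
  rw [mem_ofPred_eq, extendYset_unit]
  refine hf x fun hxA => hx ?_
  change A ∈ hq.ultrafilterMap (stoneCechUnit x)
  rw [hq.ultrafilterMap_unit]
  exact hxA

end Extension

section Components

variable {X I : Type} [TopologicalSpace X] {q : X → I}

theorem exists_ideal_coe_eq_CS (hq : IsLocallyConstant q) (hs : ∀ i, IsSeparable (q ⁻¹' {i})) :
    ∃ J : Ideal (X →ᵇ ℂ), (J : Set (X →ᵇ ℂ)) = CS X := by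
  refine ⟨{ carrier := CS X, add_mem' := ?_, zero_mem' := ?_, smul_mem' := ?_ }, rfl⟩
  · intro f g hf hg
    obtain ⟨A, hA, hf⟩ := (mem_CS_iff hq hs).1 hf
    obtain ⟨B, hB, hg⟩ := (mem_CS_iff hq hs).1 hg
    refine (mem_CS_iff hq hs).2 ⟨A ∪ B, hA.union hB, fun x hx => ?_⟩
    simp [hf x fun h => hx (Or.inl h), hg x fun h => hx (Or.inr h)]
  · exact (mem_CS_iff hq hs).2 ⟨∅, countable_empty, by simp⟩
  · intro c f hf
    obtain ⟨A, hA, hf⟩ := (mem_CS_iff hq hs).1 hf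
    exact (mem_CS_iff hq hs).2 ⟨A, hA, fun x hx => by simp [hf x hx]⟩

theorem isClosed_CS (hq : IsLocallyConstant q) (hs : ∀ i, IsSeparable (q ⁻¹' {i})) :
    IsClosed (CS X) := by
  refine IsSeqClosed.isClosed fun f g hf hfg => ?_
  have := fun n => (mem_CS_iff hq hs).1 (hf n)
  choose A hA h using this
  refine (mem_CS_iff hq hs).2 ⟨⋃ n, A n, countable_iUnion hA, fun x hx => ?_⟩
  have h1 : Tendsto (fun n => f n x) atTop (nhds (g x)) :=
    ((BoundedContinuousFunction.lipschitz_eval_const x).continuous.tendsto g).comp hfg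
  refine tendsto_nhds_unique h1 (tendsto_const_nhds.congr fun n => ?_)
  exact (h n x fun hn => hx (mem_iUnion.2 ⟨n, hn⟩)).symm

open Classical in
/-- The indicator function of the components indexed by `A`. -/
def IsLocallyConstant.indicatorBCF (hq : IsLocallyConstant q) (A : Set I) : X →ᵇ ℂ :=
  BoundedContinuousFunction.ofNormedAddCommGroup (fun x => if q x ∈ A then (1 : ℂ) else 0)
    (hq.comp fun i => if i ∈ A then (1 : ℂ) else 0).continuous 1
    (fun x => by split_ifs <;> simp)

open Classical in
theorem IsLocallyConstant.indicatorBCF_apply (hq : IsLocallyConstant q) (A : Set I) (x : X) :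
    hq.indicatorBCF A x = if q x ∈ A then 1 else 0 := rfl

theorem IsLocallyConstant.indicatorBCF_mem_CS (hq : IsLocallyConstant q)
    (hs : ∀ i, IsSeparable (q ⁻¹' {i})) {A : Set I} (hA : A.Countable) :
    hq.indicatorBCF A ∈ CS X :=
  (mem_CS_iff hq hs).2 ⟨A, hA, fun x hx => by simp [hq.indicatorBCF_apply, hx]⟩

theorem exists_unit_iff_countable (hq : IsLocallyConstant q) (hsurj : Function.Surjective q)
    (hs : ∀ i, IsSeparable (q ⁻¹' {i})) :
    (∃ u ∈ CS X, ∀ f ∈ CS X, u * f = f) ↔ Countable I := by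
  constructor
  · rintro ⟨u, hu, huf⟩
    obtain ⟨A, hA, h⟩ := (mem_CS_iff hq hs).1 hu
    refine countable_univ_iff.1 (hA.mono fun i _ => ?_)
    by_contra hi
    obtain ⟨x, rfl⟩ := hsurj i
    have := DFunLike.congr_fun
      (huf _ (hq.indicatorBCF_mem_CS hs (countable_singleton (q x)))) x
    simp [hq.indicatorBCF_apply, h x hi] at this
  · intro _
    exact ⟨1, (mem_CS_iff hq hs).2 ⟨univ, to_countable _, by simp⟩, fun f _ => one_mul f⟩

theorem isCompact_Yset_iff_countable (hq : IsLocallyConstant q)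
    (hsurj : Function.Surjective q) (hs : ∀ i, IsSeparable (q ⁻¹' {i})) :
    IsCompact (Yset X) ↔ Countable I := by
  constructor
  · intro h
    obtain ⟨A, hA, hAY⟩ := exists_countable_of_isCompact hq hs h subset_rfl
    refine countable_univ_iff.1 (hA.mono fun i _ => ?_)
    obtain ⟨x, rfl⟩ := hsurj i
    have := hAY _ (range_stoneCechUnit_subset_Yset ⟨x, rfl⟩)
    rwa [hq.ultrafilterMap_unit] at this
  · intro _
    have : Yset X = univ := eq_univ_of_forall fun y =>
      (mem_Yset_iff hq hs).2 ⟨univ, to_countable _, univ_mem⟩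
    rw [this]
    exact isCompact_univ

theorem normalSpace_Yset_iff_isCompact (hq : IsLocallyConstant q)
    (hsurj : Function.Surjective q) (hs : ∀ i, IsSeparable (q ⁻¹' {i})) :
    NormalSpace (Yset X) ↔ IsCompact (Yset X) := by
  constructor
  · intro h
    rw [isCompact_Yset_iff_countable hq hsurj hs, ← not_uncountable_iff]
    exact fun _ => not_normalSpace_Yset hq hsurj hs h
  · intro h
    have := isCompact_iff_compactSpace.1 h
    infer_instance

theorem densityCard_eq_mk [Infinite I] (hq : IsLocallyConstant q)
    (hsurj : Function.Surjective q) {σ : I × ℕ → X} (hσ : DenseRange σ) :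
    densityCard X = Cardinal.mk I := by
  refine le_antisymm ?_ ?_
  · refine (csInf_le' (show Cardinal.mk (range σ) ∈
      {c | ∃ D : Set X, Dense D ∧ Cardinal.mk D = c} from ⟨_, hσ, rfl⟩)).trans
      (Cardinal.mk_range_le.trans ?_)
    simp
  · refine le_csInf ⟨_, range σ, hσ, rfl⟩ ?_
    rintro _ ⟨D, hD, rfl⟩
    refine Cardinal.mk_le_of_surjective (f := fun d : D => q d) fun i => ?_
    obtain ⟨x, rfl⟩ := hsurj i
    obtain ⟨d, hd, hdD⟩ := hD.inter_open_nonempty (q ⁻¹' {q x}) (hq _) ⟨x, rfl⟩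
    exact ⟨⟨d, hdD⟩, hd⟩

/-- Each component has a dense sequence. -/
theorem exists_dense_sequences (hsurj : Function.Surjective q) [MetrizableSpace X]
    (hs : ∀ i, IsSeparable (q ⁻¹' {i})) :
    ∃ σ : I × ℕ → X, ∀ x, x ∈ closure (range fun n => σ (q x, n)) := by
  let := metrizableSpaceMetric X
  have : ∀ i, ∃ u : ℕ → X, q ⁻¹' {i} ⊆ closure (range u) := by
    intro i
    have h1 := (hs i).separableSpace
    obtain ⟨x, hx⟩ := hsurj i
    have : Nonempty (q ⁻¹' {i}) := ⟨⟨x, hx⟩⟩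
    obtain ⟨u, hu⟩ := exists_dense_seq (q ⁻¹' {i})
    refine ⟨fun n => u n, fun y hy => ?_⟩
    have := image_closure_subset_closure_image (f := Subtype.val) continuous_subtype_val
      (mem_image_of_mem _ (hu ⟨y, hy⟩))
    rwa [← range_comp] at this
  choose u hcl using this
  exact ⟨fun p => u p.1 p.2, fun x => hcl (q x) rfl⟩

theorem mk_CS_le [Infinite I] (hq : IsLocallyConstant q)
    (hs : ∀ i, IsSeparable (q ⁻¹' {i})) {σ : I × ℕ → X}
    (hσ : ∀ x, x ∈ closure (range fun n => σ (q x, n))) :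
    Cardinal.mk (CS X) ≤ Cardinal.mk I ^ Cardinal.aleph0 := by
  have : ∀ f : CS X, ∃ a : ℕ → I, ∀ x, q x ∉ range a → f.1 x = 0 := by
    intro f
    obtain ⟨A, hA, h⟩ := (mem_CS_iff hq hs).1 f.2
    obtain ⟨a, ha⟩ := countable_iff_exists_subset_range.1 hA
    exact ⟨a, fun x hx => h x fun hxA => hx (ha hxA)⟩
  choose a ha using this
  let Ψ : CS X → (ℕ → I) × (ℕ × ℕ → ℂ) := fun f => (a f, fun p => f.1 (σ (a f p.1, p.2)))
  have hΨ : Function.Injective Ψ := by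
    intro f g hfg
    obtain ⟨h1, h2⟩ := Prod.ext_iff.1 hfg
    change a f = a g at h1
    refine Subtype.ext (BoundedContinuousFunction.ext fun x => ?_)
    by_cases hx : q x ∈ range (a f)
    · obtain ⟨k, hk⟩ := hx
      refine closure_minimal (t := {z | f.1 z = g.1 z}) ?_
        (isClosed_eq f.1.continuous g.1.continuous) (hσ x)
      rintro _ ⟨n, rfl⟩
      have := congrFun h2 (k, n)
      simp only [Ψ, ← h1, hk] at this
      exact this
    · rw [ha f x hx, ha g x (h1 ▸ hx)]
  refine (Cardinal.mk_le_of_injective hΨ).trans ?_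
  have hI : Cardinal.aleph0 ≤ Cardinal.mk I := Cardinal.aleph0_le_mk I
  have h2 : (2 : Cardinal) ≤ Cardinal.mk I := (Cardinal.natCast_lt_aleph0 (n := 2)).le.trans hI
  have hc : Cardinal.continuum ≤ Cardinal.mk I ^ Cardinal.aleph0 := by
    rw [← Cardinal.two_power_aleph0]
    exact Cardinal.power_le_power_right h2
  simp only [Cardinal.mk_prod, Cardinal.lift_id, ← Cardinal.power_def, Cardinal.mk_eq_aleph0,
    Cardinal.mk_complex, Cardinal.continuum_power_aleph0]
  rw [Cardinal.mul_eq_left (hI.trans (Cardinal.self_le_power _ Cardinal.one_le_aleph0)) hc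
    Cardinal.continuum_ne_zero]

/-- An infinite type `I` carries an almost disjoint family of sequences indexed by the
sequences in `I`. -/
theorem exists_almost_disjoint_family (I : Type) [Infinite I] :
    ∃ B : (ℕ → I) → ℕ → I, ∀ s t, s ≠ t → ∃ N, ∀ n ≥ N, B s n ∉ range (B t) := by
  obtain ⟨e⟩ := Cardinal.eq.1 (Cardinal.mk_list_eq_mk I)
  refine ⟨fun s n => e (List.ofFn fun k : Fin n => s k), ?_⟩
  intro s t hst
  obtain ⟨k, hk⟩ := Function.ne_iff.1 hst
  refine ⟨k + 1, ?_⟩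
  rintro n hn ⟨m, hm⟩
  have h1 := e.injective hm
  obtain rfl : m = n := by simpa using congrArg List.length h1
  have h2 := congrFun (List.ofFn_injective h1) ⟨k, hn⟩
  exact hk h2.symm

theorem linearIndependent_indicatorBCF (hq : IsLocallyConstant q)
    (hsurj : Function.Surjective q) {S : Type} {B : S → ℕ → I}
    (hB : ∀ s t, s ≠ t → ∃ N, ∀ n ≥ N, B s n ∉ range (B t)) :
    LinearIndependent ℂ fun s => hq.indicatorBCF (range (B s)) := by
  classical
  rw [linearIndependent_iff']
  intro F c hc s hsF
  have : ∀ t, ∃ N, t ≠ s → ∀ n ≥ N, B s n ∉ range (B t) := by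
    intro t
    by_cases h : t = s
    · exact ⟨0, fun h' => absurd h h'⟩
    · obtain ⟨N, hN⟩ := hB s t (Ne.symm h)
      exact ⟨N, fun _ => hN⟩
  choose N hN using this
  obtain ⟨x, hx⟩ := hsurj (B s (F.sup N))
  have h := DFunLike.congr_fun hc x
  rw [BoundedContinuousFunction.sum_apply, Finset.sum_eq_single s] at h
  · simpa [hq.indicatorBCF_apply, hx] using h
  · intro t ht hts
    have := hN t hts (F.sup N) (Finset.le_sup ht)
    simp only [BoundedContinuousFunction.coe_smul, hq.indicatorBCF_apply, hx, if_neg this,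
      smul_zero]
  · exact fun h => absurd hsF h

theorem rank_eq_densityCard_power [Infinite I] [MetrizableSpace X] (hq : IsLocallyConstant q)
    (hsurj : Function.Surjective q) (hs : ∀ i, IsSeparable (q ⁻¹' {i}))
    (p : Submodule ℂ (X →ᵇ ℂ)) (hp : (p : Set (X →ᵇ ℂ)) = CS X) :
    Module.rank ℂ p = densityCard X ^ Cardinal.aleph0 := by
  obtain ⟨σ, hσ⟩ := exists_dense_sequences hsurj hs
  have hσd : DenseRange σ := fun x => closure_mono
    (by rintro _ ⟨n, rfl⟩; exact mem_range_self _) (hσ x)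
  rw [densityCard_eq_mk hq hsurj hσd]
  refine le_antisymm ?_ ?_
  · refine (rank_le_card ℂ p).trans ?_
    have := mk_CS_le hq hs hσ
    rwa [← hp] at this
  · obtain ⟨B, hB⟩ := exists_almost_disjoint_family I
    have hmem : ∀ s, hq.indicatorBCF (range (B s)) ∈ p := by
      intro s
      rw [← SetLike.mem_coe, hp]
      exact hq.indicatorBCF_mem_CS hs (countable_range _)
    have hli : LinearIndependent ℂ fun s =>
        (⟨hq.indicatorBCF (range (B s)), hmem s⟩ : p) :=
      LinearIndependent.of_comp p.subtype (linearIndependent_indicatorBCF hq hsurj hB)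
    have := hli.cardinal_le_rank
    rwa [← Cardinal.power_def, Cardinal.mk_nat] at this

end Components

theorem stmt_18 {X : Type} [TopologicalSpace X] [MetrizableSpace X]
    (hloc : ∀ x : X, ∃ S ∈ nhds x, IsSeparable S) :
    -- (a) `C_S(X)` is a closed ideal of `C_B(X)`
    ((∃ I : Ideal (X →ᵇ ℂ), (I : Set (X →ᵇ ℂ)) = CS X) ∧ IsClosed (CS X)) ∧
    -- (b) `Y` is open in `βX`, contains `X` densely, and `C_S(X) ≅ C_0(Y)` isometrically
    (IsOpen (Yset X) ∧
      Set.range (stoneCechUnit : X → StoneCech X) ⊆ Yset X ∧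
      Dense {y : ↥(Yset X) |
        (y : StoneCech X) ∈ Set.range (stoneCechUnit : X → StoneCech X)} ∧
      (∃ Φ : (X →ᵇ ℂ) → (↥(Yset X) →ᵇ ℂ),
        (∀ f ∈ CS X,
          Filter.Tendsto (Φ f : ↥(Yset X) → ℂ) (Filter.cocompact _) (nhds 0)) ∧
        (∀ g : ↥(Yset X) →ᵇ ℂ,
          Filter.Tendsto (g : ↥(Yset X) → ℂ) (Filter.cocompact _) (nhds 0) →
          ∃ f ∈ CS X, Φ f = g) ∧
        (∀ f ∈ CS X, ∀ g ∈ CS X, Φ f = Φ g → f = g) ∧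
        (∀ f ∈ CS X, ∀ g ∈ CS X, Φ (f + g) = Φ f + Φ g) ∧
        (∀ f ∈ CS X, ∀ g ∈ CS X, Φ (f * g) = Φ f * Φ g) ∧
        (∀ (c : ℂ), ∀ f ∈ CS X, Φ (c • f) = c • Φ f) ∧
        (∀ f ∈ CS X, ‖Φ f‖ = ‖f‖))) ∧
    -- (c) `Y` is countably compact and `C_0(Y) = C_00(Y)`
    (IsCountablyCompactSet (Yset X) ∧
      {g : C(↥(Yset X), ℂ) | HasCompactSupport (g : ↥(Yset X) → ℂ)} =
        {g : C(↥(Yset X), ℂ) |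
          Filter.Tendsto (g : ↥(Yset X) → ℂ) (Filter.cocompact _) (nhds 0)}) ∧
    -- (d) `Y` normal ↔ `Y` compact ↔ `X` separable ↔ `C_S(X)` unital
    ((NormalSpace ↥(Yset X) ↔ IsCompact (Yset X)) ∧
      (IsCompact (Yset X) ↔ SeparableSpace X) ∧
      (SeparableSpace X ↔ ∃ u ∈ CS X, ∀ f ∈ CS X, u * f = f)) ∧
    -- (e) if `X` is not separable then `dim C_S(X) = d(X)^ℵ₀`
    (¬ SeparableSpace X →
      ∀ p : Submodule ℂ (X →ᵇ ℂ), (p : Set (X →ᵇ ℂ)) = CS X →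
        Module.rank ℂ ↥p = densityCard X ^ Cardinal.aleph0) := by
  obtain ⟨I, q, hq, hsurj, hs⟩ := exists_isLocallyConstant_separable_fibers hloc
  have hY := isOpen_Yset hq hs
  refine ⟨⟨exists_ideal_coe_eq_CS hq hs, isClosed_CS hq hs⟩,
    ⟨hY, range_stoneCechUnit_subset_Yset, ?_, extendYset, ?_, ?_, ?_, ?_, ?_, ?_, ?_⟩,
    ⟨isCountablyCompactSet_Yset hq hs, Set.ext fun g => hasCompactSupport_iff_tendsto hq hs g⟩,
    ⟨normalSpace_Yset_iff_isCompact hq hsurj hs, ?_, ?_⟩, ?_⟩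
  · refine (denseRange_unitYset hY).mono ?_
    rintro _ ⟨x, rfl⟩
    exact ⟨x, rfl⟩
  · intro f hf
    obtain ⟨A, hA, h⟩ := (mem_CS_iff hq hs).1 hf
    exact tendsto_cocompact_of_countable hq hs hA (extendYset_eq_zero hq hY h)
  · intro g hg
    obtain ⟨A, hA, h⟩ := exists_countable_of_tendsto_cocompact hq hs hg
    refine ⟨g.compContinuous ⟨unitYset, continuous_unitYset⟩,
      (mem_CS_iff hq hs).2 ⟨A, hA, fun x hx => h _ ?_⟩, eq_of_comp_unitYset_eq hY fun x => ?_⟩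
    · change A ∉ hq.ultrafilterMap (stoneCechUnit x)
      rwa [hq.ultrafilterMap_unit]
    · rw [extendYset_unit]
      rfl
  · intro f _ g _ hfg
    ext x
    rw [← extendYset_unit, hfg, extendYset_unit]
  · exact fun f _ g _ => eq_of_comp_unitYset_eq hY fun x => by simp [extendYset_unit]
  · exact fun f _ g _ => eq_of_comp_unitYset_eq hY fun x => by simp [extendYset_unit]
  · exact fun c f _ => eq_of_comp_unitYset_eq hY fun x => by simp [extendYset_unit]
  · exact fun f _ => norm_extendYset f
  · rw [isCompact_Yset_iff_countable hq hsurj hs, separableSpace_iff_countable hq hsurj hs]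
  · rw [exists_unit_iff_countable hq hsurj hs, separableSpace_iff_countable hq hsurj hs]
  · intro hX p hp
    rw [separableSpace_iff_countable hq hsurj hs, not_countable_iff] at hX
    exact rank_eq_densityCard_power hq hsurj hs p hp
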